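/- Let n ≥ 1, let F be the free non-unital associative algebra over the field 𝔽₃ = ℤ/3ℤ on n generators x₁, …, xₙ (for instance the semigroup algebra over 𝔽₃ of the free semigroup on n generators), and let I be the two-sided ideal of F generated by all elements abc + bac + cab + acb + bca + cba with a, b, c ∈ F. Then in the quotient F/I, the 𝔽₃-subspace spanned by the images of the n! multilinear monomials x_{σ(1)} x_{σ(2)} ⋯ x_{σ(n)} (σ ranging over all permutations of {1, …, n}) has dimension 2ⁿ − n. -/

import Mathlib

/-- The smallest `R`-submodule of `F` containing `S` and closed under left and
right multiplication by arbitrary elements of `F`: the two-sided ideal of the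
(possibly non-unital) algebra `F` generated by `S`, viewed as a submodule. -/
def idealClosure (R F : Type*) [CommRing R] [AddCommGroup F] [Mul F] [Module R F]
    (S : Set F) : Submodule R F :=
  sInf {p : Submodule R F | S ⊆ p ∧ ∀ a : F, ∀ x ∈ p, a * x ∈ p ∧ x * a ∈ p}

/-- The free non-unital associative algebra over `𝔽₃` on `n` generators
(the semigroup algebra of the free semigroup on `n` generators). -/
abbrev FreeAssocF3 (n : ℕ) : Type := MonoidAlgebra (ZMod 3) (FreeSemigroup (Fin n))

/-- The generators of `FreeAssocF3 n`. -/
noncomputable def xgen (n : ℕ) (i : Fin n) : FreeAssocF3 n :=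
  MonoidAlgebra.single (FreeSemigroup.of i) 1

/-- The multilinear monomial `x_{σ(1)} x_{σ(2)} ⋯ x_{σ(n)}` in `FreeAssocF3 n`
(for `n = m + 1`) attached to a permutation `σ`. -/
noncomputable def multilinearMonomial (m : ℕ) (σ : Equiv.Perm (Fin (m + 1))) :
    FreeAssocF3 (m + 1) :=
  (List.ofFn fun i : Fin m => xgen (m + 1) (σ i.succ)).foldl (· * ·)
    (xgen (m + 1) (σ 0))

/-- The two-sided ideal of `FreeAssocF3 n` generated by all symmetric sums
`abc + bac + cab + acb + bca + cba`. -/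
noncomputable def dualAltIdealF3 (n : ℕ) : Submodule (ZMod 3) (FreeAssocF3 n) :=
  idealClosure (ZMod 3) (FreeAssocF3 n)
    {w | ∃ a b c : FreeAssocF3 n,
      w = a * b * c + b * a * c + c * a * b + a * c * b + b * c * a + c * b * a}

section Propagation

variable {R ι : Type*} [Ring R]

/-- The identities, for elements of `S`, that make the left-normed commutators of a ring satisfying
the linearized `2`-Engel identity alternating. -/
structure EngelOn (S : Set R) : Prop where
  triple_mul_triple : ∀ a ∈ S, ∀ b ∈ S, ∀ c ∈ S, ∀ d ∈ S, ∀ e ∈ S, ∀ f ∈ S,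
    ⁅⁅a, b⁆, c⁆ * ⁅⁅d, e⁆, f⁆ = 0
  pair_mul_triple : ∀ a ∈ S, ∀ b ∈ S, ∀ c ∈ S, ∀ d ∈ S, ∀ e ∈ S,
    ⁅a, b⁆ * ⁅⁅c, d⁆, e⁆ + ⁅a, c⁆ * ⁅⁅b, d⁆, e⁆ = 0
  central : ∀ a ∈ S, ∀ b ∈ S, ∀ c ∈ S, ∀ d ∈ S, ⁅⁅⁅a, b⁆, c⁆, d⁆ = 0
  pair_mul_pair : ∀ a ∈ S, ∀ b ∈ S, ∀ c ∈ S, ∀ d ∈ S,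
    ⁅a, b⁆ * ⁅c, d⁆ + ⁅a, c⁆ * ⁅b, d⁆ = 0
  engel : ∀ a ∈ S, ∀ b ∈ S, ∀ c ∈ S, ⁅⁅a, b⁆, c⁆ + ⁅⁅a, c⁆, b⁆ = 0

/-- `IsWord S n a` says that `a` is a product of `n ≥ 1` elements of `S`. -/
inductive IsWord (S : Set R) : ℕ → R → Prop
  | of {a : R} : a ∈ S → IsWord S 1 a
  | mul {p q : ℕ} {a b : R} : IsWord S p a → IsWord S q b → IsWord S (p + q) (a * b)

lemma IsWord.pos {S : Set R} {n : ℕ} {a : R} (h : IsWord S n a) : 0 < n := by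
  induction h <;> omega

/-- The identities of `EngelOn` for words in `S` of total length `N`. -/
structure EngelAt (S : Set R) (N : ℕ) : Prop where
  triple_mul_triple : ∀ {p q r s t u : ℕ} {a b c d e f : R}, IsWord S p a → IsWord S q b →
    IsWord S r c → IsWord S s d → IsWord S t e → IsWord S u f → p + q + r + s + t + u = N →
    ⁅⁅a, b⁆, c⁆ * ⁅⁅d, e⁆, f⁆ = 0
  pair_mul_triple : ∀ {p q r s t : ℕ} {a b c d e : R}, IsWord S p a → IsWord S q b →
    IsWord S r c → IsWord S s d → IsWord S t e → p + q + r + s + t = N →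
    ⁅a, b⁆ * ⁅⁅c, d⁆, e⁆ + ⁅a, c⁆ * ⁅⁅b, d⁆, e⁆ = 0
  central : ∀ {p q r s : ℕ} {a b c d : R}, IsWord S p a → IsWord S q b →
    IsWord S r c → IsWord S s d → p + q + r + s = N → ⁅⁅⁅a, b⁆, c⁆, d⁆ = 0
  pair_mul_pair : ∀ {p q r s : ℕ} {a b c d : R}, IsWord S p a → IsWord S q b →
    IsWord S r c → IsWord S s d → p + q + r + s = N →
    ⁅a, b⁆ * ⁅c, d⁆ + ⁅a, c⁆ * ⁅b, d⁆ = 0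
  engel : ∀ {p q r : ℕ} {a b c : R}, IsWord S p a → IsWord S q b →
    IsWord S r c → p + q + r = N → ⁅⁅a, b⁆, c⁆ + ⁅⁅a, c⁆, b⁆ = 0

variable {S : Set R} {N : ℕ}

lemma EngelOn.triple_mul_triple_word (hS : EngelOn S) (ih : ∀ m < N, EngelAt S m)
    {p q r s t u : ℕ} {a b c d e f : R} (ha : IsWord S p a) (hb : IsWord S q b)
    (hc : IsWord S r c) (hd : IsWord S s d) (he : IsWord S t e) (hf : IsWord S u f)
    (hN : p + q + r + s + t + u = N) : ⁅⁅a, b⁆, c⁆ * ⁅⁅d, e⁆, f⁆ = 0 := by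
  have left : ∀ {p p' q r : ℕ} {a a' b c : R}, IsWord S p a → IsWord S p' a' → IsWord S q b →
      IsWord S r c → p + p' + q + r + s + t + u = N →
      ⁅⁅a * a', b⁆, c⁆ * ⁅⁅d, e⁆, f⁆ = 0 := by
    intro p p' q r a a' b c ha ha' hb hc h
    have := ha.pos; have := ha'.pos; have := hd.pos
    have w1 := (ih _ (by omega)).triple_mul_triple ha' hb hc hd he hf rfl
    have w2 := (ih _ (by omega)).triple_mul_triple ha hb hc hd he hf rfl
    have z := (ih _ (by have := hb.pos; omega)).central hd he hf ha' rfl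
    have q := (ih _ (by omega)).pair_mul_pair ha hb hc ha' rfl
    linear_combination (norm := (simp only [Ring.lie_def]; noncomm_ring))
      a * w1 + w2 * a' - ⁅⁅a, b⁆, c⁆ * z - q * ⁅⁅d, e⁆, f⁆
  have right : ∀ {s s' t u : ℕ} {d d' e f : R}, IsWord S s d → IsWord S s' d' → IsWord S t e →
      IsWord S u f → p + q + r + (s + s') + t + u = N →
      ⁅⁅a, b⁆, c⁆ * ⁅⁅d * d', e⁆, f⁆ = 0 := by
    intro s s' t u d d' e f hd hd' he hf h
    have := hd.pos; have := hd'.pos; have := ha.pos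
    have w1 := (ih _ (by omega)).triple_mul_triple ha hb hc hd' he hf rfl
    have w2 := (ih _ (by omega)).triple_mul_triple ha hb hc hd he hf rfl
    have z := (ih _ (by have := he.pos; omega)).central ha hb hc hd rfl
    have q := (ih _ (by omega)).pair_mul_pair hd he hf hd' rfl
    linear_combination (norm := (simp only [Ring.lie_def]; noncomm_ring))
      d * w1 + w2 * d' + z * ⁅⁅d', e⁆, f⁆ - ⁅⁅a, b⁆, c⁆ * q
  have := ha.pos; have := hd.pos
  cases ha with
  | mul ha ha' => exact left ha ha' hb hc (by omega)
  | of ha₀ =>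
  have ha := IsWord.of ha₀
  cases hb with
  | mul hb hb' =>
    linear_combination (norm := (simp only [Ring.lie_def]; noncomm_ring))
      -left hb hb' ha hc (by omega)
  | of hb₀ =>
  have hb := IsWord.of hb₀
  cases hc with
  | mul hc hc' =>
    have E := (ih _ (by omega)).engel ha hb (hc.mul hc') rfl
    linear_combination (norm := (simp only [Ring.lie_def]; noncomm_ring))
      E * ⁅⁅d, e⁆, f⁆ + left hc hc' ha hb (by omega)
  | of hc₀ =>
  have hc := IsWord.of hc₀
  cases hd with
  | mul hd hd' => exact right hd hd' he hf (by omega)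
  | of hd₀ =>
  have hd := IsWord.of hd₀
  cases he with
  | mul he he' =>
    linear_combination (norm := (simp only [Ring.lie_def]; noncomm_ring))
      -right he he' hd hf (by omega)
  | of he₀ =>
  have he := IsWord.of he₀
  cases hf with
  | mul hf hf' =>
    have E := (ih _ (by omega)).engel hd he (hf.mul hf') rfl
    linear_combination (norm := (simp only [Ring.lie_def]; noncomm_ring))
      ⁅⁅a, b⁆, c⁆ * E + right hf hf' hd he (by omega)
  | of hf₀ => exact hS.triple_mul_triple _ ha₀ _ hb₀ _ hc₀ _ hd₀ _ he₀ _ hf₀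

lemma EngelOn.pair_mul_triple_word (hS : EngelOn S) (ih : ∀ m < N, EngelAt S m)
    {p q r s t : ℕ} {a b c d e : R} (ha : IsWord S p a) (hb : IsWord S q b)
    (hc : IsWord S r c) (hd : IsWord S s d) (he : IsWord S t e) (hN : p + q + r + s + t = N) :
    ⁅a, b⁆ * ⁅⁅c, d⁆, e⁆ + ⁅a, c⁆ * ⁅⁅b, d⁆, e⁆ = 0 := by
  have snd : ∀ {q r r' : ℕ} {b c c' : R}, IsWord S q b → IsWord S r c → IsWord S r' c' →
      p + q + (r + r') + s + t = N →
      ⁅a, b⁆ * ⁅⁅c * c', d⁆, e⁆ + ⁅a, c * c'⁆ * ⁅⁅b, d⁆, e⁆ = 0 := by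
    intro q r r' b c c' hb hc hc' h
    have := ha.pos; have := hb.pos; have := hc.pos; have := hc'.pos
    have p1 := (ih _ (by omega)).pair_mul_triple ha hb hc' hd he rfl
    have p2 := (ih _ (by omega)).pair_mul_triple ha hb hc hd he rfl
    have w := hS.triple_mul_triple_word ih ha hb hc hc' hd he (by omega)
    have z := (ih _ (by omega)).central hb hd he hc' rfl
    have q := (ih _ (by omega)).pair_mul_pair hc hd he hc' rfl
    linear_combination (norm := (simp only [Ring.lie_def]; noncomm_ring))
      c * p1 + w + p2 * c' - ⁅a, c⁆ * z - ⁅a, b⁆ * q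
  have fourth : ∀ {s s' t : ℕ} {d d' e : R}, IsWord S s d → IsWord S s' d' → IsWord S t e →
      p + q + r + (s + s') + t = N →
      ⁅a, b⁆ * ⁅⁅c, d * d'⁆, e⁆ + ⁅a, c⁆ * ⁅⁅b, d * d'⁆, e⁆ = 0 := by
    intro s s' t d d' e hd hd' he h
    have := ha.pos; have := hb.pos; have := hc.pos; have := hd.pos; have := hd'.pos
    have p1 := (ih _ (by omega)).pair_mul_triple ha hb hc hd' he rfl
    have p2 := (ih _ (by omega)).pair_mul_triple ha hb hc hd he rfl
    have w1 := hS.triple_mul_triple_word ih ha hb hd hd' hc he (by omega)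
    have w2 := hS.triple_mul_triple_word ih ha hc hd hd' hb he (by omega)
    have q1 := (ih _ (by omega)).pair_mul_pair hd hc he hd' rfl
    have q2 := (ih _ (by omega)).pair_mul_pair hd hb he hd' rfl
    linear_combination (norm := (simp only [Ring.lie_def]; noncomm_ring))
      d * p1 + p2 * d' - w1 - w2 + ⁅a, b⁆ * q1 + ⁅a, c⁆ * q2
  have := ha.pos; have := hb.pos; have := hc.pos
  cases ha with
  | @mul _ _ a a' ha ha' =>
    have := ha.pos; have := ha'.pos
    have p1 := (ih _ (by omega)).pair_mul_triple ha' hb hc hd he rfl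
    have p2 := (ih _ (by omega)).pair_mul_triple ha hb hc hd he rfl
    have z1 := (ih _ (by omega)).central hc hd he ha' rfl
    have z2 := (ih _ (by omega)).central hb hd he ha' rfl
    linear_combination (norm := (simp only [Ring.lie_def]; noncomm_ring))
      a * p1 + p2 * a' - ⁅a, b⁆ * z1 - ⁅a, c⁆ * z2
  | of ha₀ =>
  have ha := IsWord.of ha₀
  cases hb with
  | mul hb hb' => linear_combination (norm := noncomm_ring) snd hc hb hb' (by omega)
  | of hb₀ =>
  have hb := IsWord.of hb₀
  cases hc with
  | mul hc hc' => exact snd hb hc hc' (by omega)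
  | of hc₀ =>
  have hc := IsWord.of hc₀
  cases hd with
  | mul hd hd' => exact fourth hd hd' he (by omega)
  | of hd₀ =>
  have hd := IsWord.of hd₀
  cases he with
  | mul he he' =>
    have E1 := (ih _ (by omega)).engel hc hd (he.mul he') rfl
    have E2 := (ih _ (by omega)).engel hb hd (he.mul he') rfl
    linear_combination (norm := noncomm_ring)
      ⁅a, b⁆ * E1 + ⁅a, c⁆ * E2 - fourth he he' hd (by omega)
  | of he₀ => exact hS.pair_mul_triple _ ha₀ _ hb₀ _ hc₀ _ hd₀ _ he₀

lemma EngelOn.central_word (hS : EngelOn S) (ih : ∀ m < N, EngelAt S m)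
    {p q r s : ℕ} {a b c d : R} (ha : IsWord S p a) (hb : IsWord S q b)
    (hc : IsWord S r c) (hd : IsWord S s d) (hN : p + q + r + s = N) :
    ⁅⁅⁅a, b⁆, c⁆, d⁆ = 0 := by
  have fst : ∀ {p p' q r : ℕ} {a a' b c : R}, IsWord S p a → IsWord S p' a' → IsWord S q b →
      IsWord S r c → p + p' + q + r + s = N → ⁅⁅⁅a * a', b⁆, c⁆, d⁆ = 0 := by
    intro p p' q r a a' b c ha ha' hb hc h
    have := ha.pos; have := ha'.pos; have := hd.pos
    have z1 := (ih _ (by omega)).central ha' hb hc hd rfl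
    have z2 := (ih _ (by omega)).central ha hb hc hd rfl
    have z3 := (ih _ (by omega)).central ha hb hc ha' rfl
    have q := (ih _ (by omega)).pair_mul_pair ha hb hc ha' rfl
    have P := hS.pair_mul_triple_word ih hd ha ha' hb hc (by omega)
    linear_combination (norm := (simp only [Ring.lie_def]; noncomm_ring))
      a * z1 + z2 * a' - q * d + d * q + z3 * d - d * z3 + a' * z2 - z2 * a' - P
  have := ha.pos; have := hb.pos; have := hc.pos; have := hd.pos
  cases ha with
  | mul ha ha' => exact fst ha ha' hb hc (by omega)
  | of ha₀ =>
  have ha := IsWord.of ha₀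
  cases hb with
  | mul hb hb' =>
    linear_combination (norm := (simp only [Ring.lie_def]; noncomm_ring))
      -fst hb hb' ha hc (by omega)
  | of hb₀ =>
  have hb := IsWord.of hb₀
  cases hc with
  | mul hc hc' =>
    have E := (ih _ (by omega)).engel ha hb (hc.mul hc') rfl
    linear_combination (norm := (simp only [Ring.lie_def]; noncomm_ring))
      E * d - d * E + fst hc hc' ha hb (by omega)
  | of hc₀ =>
  have hc := IsWord.of hc₀
  cases hd with
  | @mul _ _ d d' hd hd' =>
    have := hd.pos; have := hd'.pos
    have z1 := (ih _ (by omega)).central ha hb hc hd' rfl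
    have z2 := (ih _ (by omega)).central ha hb hc hd rfl
    linear_combination (norm := (simp only [Ring.lie_def]; noncomm_ring)) d * z1 + z2 * d'
  | of hd₀ => exact hS.central _ ha₀ _ hb₀ _ hc₀ _ hd₀

lemma EngelOn.pair_mul_pair_word (hS : EngelOn S) (ih : ∀ m < N, EngelAt S m)
    {p q r s : ℕ} {a b c d : R} (ha : IsWord S p a) (hb : IsWord S q b)
    (hc : IsWord S r c) (hd : IsWord S s d) (hN : p + q + r + s = N) :
    ⁅a, b⁆ * ⁅c, d⁆ + ⁅a, c⁆ * ⁅b, d⁆ = 0 := by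
  have snd : ∀ {q q' r : ℕ} {b b' c : R}, IsWord S q b → IsWord S q' b' → IsWord S r c →
      p + (q + q') + r + s = N →
      ⁅a, b * b'⁆ * ⁅c, d⁆ + ⁅a, c⁆ * ⁅b * b', d⁆ = 0 := by
    intro q q' r b b' c hb hb' hc h
    have := ha.pos; have := hb.pos; have := hb'.pos; have := hc.pos; have := hd.pos
    have q1 := (ih _ (by omega)).pair_mul_pair ha hb' hc hd rfl
    have q2 := (ih _ (by omega)).pair_mul_pair ha hb hc hd rfl
    have z1 := (ih _ (by omega)).central ha hc hb hb' rfl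
    have z2 := (ih _ (by omega)).central ha hc hb hd rfl
    have p1 := hS.pair_mul_triple_word ih hd hb' ha hc hb (by omega)
    have p2 := hS.pair_mul_triple_word ih ha hd hb' hc hb (by omega)
    have p3 := hS.pair_mul_triple_word ih ha hb' hb hd hc (by omega)
    have E1 := (ih _ (by omega)).engel hd hc hb rfl
    have E2 := (ih _ (by omega)).engel hd hb' hc rfl
    linear_combination (norm := (simp only [Ring.lie_def]; noncomm_ring))
      b * q1 + q2 * b' + (z1 * d - d * z1 + b' * z2 - z2 * b') - p1 - p2 + p3
        + ⁅a, b'⁆ * E1 + ⁅a, b⁆ * E2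
  have := ha.pos; have := hb.pos; have := hc.pos; have := hd.pos
  cases ha with
  | @mul _ _ a a' ha ha' =>
    have := ha.pos; have := ha'.pos
    have q1 := (ih _ (by omega)).pair_mul_pair ha' hb hc hd rfl
    have q2 := (ih _ (by omega)).pair_mul_pair ha hb hc hd rfl
    have P := hS.pair_mul_triple_word ih ha hb hc hd ha' (by omega)
    linear_combination (norm := (simp only [Ring.lie_def]; noncomm_ring))
      a * q1 + q2 * a' - P
  | of ha₀ =>
  have ha := IsWord.of ha₀
  cases hb with
  | mul hb hb' => exact snd hb hb' hc (by omega)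
  | of hb₀ =>
  have hb := IsWord.of hb₀
  cases hc with
  | mul hc hc' => linear_combination (norm := noncomm_ring) snd hc hc' hb (by omega)
  | of hc₀ =>
  have hc := IsWord.of hc₀
  cases hd with
  | @mul _ _ d d' hd hd' =>
    have := hd.pos; have := hd'.pos
    have q1 := (ih _ (by omega)).pair_mul_pair ha hb hc hd' rfl
    have q2 := (ih _ (by omega)).pair_mul_pair ha hb hc hd rfl
    have z1 := (ih _ (by omega)).central ha hb hd hc rfl
    have z2 := (ih _ (by omega)).central ha hb hd hd' rfl
    have z3 := (ih _ (by omega)).central ha hc hd hb rfl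
    have z4 := (ih _ (by omega)).central ha hc hd hd' rfl
    have P := hS.pair_mul_triple_word ih hd' hc hb ha hd (by omega)
    linear_combination (norm := (simp only [Ring.lie_def]; noncomm_ring))
      d * q1 + q2 * d' + (z1 * d' - d' * z1 + c * z2 - z2 * c)
        + (z3 * d' - d' * z3 + b * z4 - z4 * b) + P
  | of hd₀ => exact hS.pair_mul_pair _ ha₀ _ hb₀ _ hc₀ _ hd₀

lemma EngelOn.engel_word (hS : EngelOn S) (ih : ∀ m < N, EngelAt S m)
    {p q r : ℕ} {a b c : R} (ha : IsWord S p a) (hb : IsWord S q b)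
    (hc : IsWord S r c) (hN : p + q + r = N) : ⁅⁅a, b⁆, c⁆ + ⁅⁅a, c⁆, b⁆ = 0 := by
  have snd : ∀ {q q' r : ℕ} {b b' c : R}, IsWord S q b → IsWord S q' b' → IsWord S r c →
      p + (q + q') + r = N → ⁅⁅a, b * b'⁆, c⁆ + ⁅⁅a, c⁆, b * b'⁆ = 0 := by
    intro q q' r b b' c hb hb' hc h
    have := hb.pos; have := hb'.pos
    have e1 := (ih _ (by omega)).engel ha hb' hc rfl
    have e2 := (ih _ (by omega)).engel ha hb hc rfl
    have z1 := hS.central_word ih hb hc ha hb' (by omega)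
    have z2 := hS.central_word ih hb hc hb' ha (by omega)
    have Q := hS.pair_mul_pair_word ih ha hb hb' hc (by omega)
    linear_combination (norm := (simp only [Ring.lie_def]; noncomm_ring))
      b * e1 + e2 * b' + Q + z1 - z2
  cases ha with
  | @mul _ _ a a' ha ha' =>
    have := ha.pos; have := ha'.pos
    have e1 := (ih _ (by omega)).engel ha' hb hc rfl
    have e2 := (ih _ (by omega)).engel ha hb hc rfl
    have Q := hS.pair_mul_pair_word ih ha hb hc ha' (by omega)
    linear_combination (norm := (simp only [Ring.lie_def]; noncomm_ring))
      a * e1 + e2 * a' - 2 * Q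
  | of ha₀ =>
  have ha := IsWord.of ha₀
  cases hb with
  | mul hb hb' => exact snd hb hb' hc (by omega)
  | of hb₀ =>
  have hb := IsWord.of hb₀
  cases hc with
  | mul hc hc' => linear_combination (norm := noncomm_ring) snd hc hc' hb (by omega)
  | of hc₀ => exact hS.engel _ ha₀ _ hb₀ _ hc₀

lemma EngelOn.engelAt (hS : EngelOn S) (N : ℕ) : EngelAt S N := by
  induction N using Nat.strong_induction_on with
  | _ N ih => exact ⟨hS.triple_mul_triple_word ih, hS.pair_mul_triple_word ih,
      hS.central_word ih, hS.pair_mul_pair_word ih, hS.engel_word ih⟩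

/-- The linearized `2`-Engel identity propagates from generators to the algebra they generate. -/
lemma EngelOn.engel_adjoin {k : Type*} [CommRing k] [Algebra k R] (hS : EngelOn S) {a b c : R}
    (ha : a ∈ Algebra.adjoin k S) (hb : b ∈ Algebra.adjoin k S) (hc : c ∈ Algebra.adjoin k S) :
    ⁅⁅a, b⁆, c⁆ + ⁅⁅a, c⁆, b⁆ = 0 := by
  have word : ∀ a ∈ Submonoid.closure S, a = 1 ∨ ∃ n, IsWord S n a := by
    intro a ha
    induction ha using Submonoid.closure_induction with
    | mem x hx => exact .inr ⟨1, .of hx⟩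
    | one => exact .inl rfl
    | mul x y _ _ hx hy =>
      rcases hx with rfl | ⟨n, hx⟩
      · simpa using hy
      rcases hy with rfl | ⟨m, hy⟩
      · simpa using Or.inr ⟨n, hx⟩
      exact .inr ⟨_, hx.mul hy⟩
  rw [← Subalgebra.mem_toSubmodule, Algebra.adjoin_eq_span] at ha hb hc
  induction ha using Submodule.span_induction with
  | zero => simp [Ring.lie_def]
  | add x y _ _ hx hy =>
    linear_combination (norm := (simp only [Ring.lie_def]; noncomm_ring)) hx + hy
  | smul r x _ hx =>
    have := congrArg (r • ·) hx
    simpa only [Ring.lie_def, smul_mul_assoc, mul_smul_comm, smul_sub, smul_add, sub_mul, mul_sub,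
      smul_zero] using this
  | mem a ha =>
  induction hb using Submodule.span_induction with
  | zero => simp [Ring.lie_def]
  | add x y _ _ hx hy =>
    linear_combination (norm := (simp only [Ring.lie_def]; noncomm_ring)) hx + hy
  | smul r x _ hx =>
    have := congrArg (r • ·) hx
    simpa only [Ring.lie_def, smul_mul_assoc, mul_smul_comm, smul_sub, smul_add, sub_mul, mul_sub,
      smul_zero] using this
  | mem b hb =>
  induction hc using Submodule.span_induction with
  | zero => simp [Ring.lie_def]
  | add x y _ _ hx hy =>
    linear_combination (norm := (simp only [Ring.lie_def]; noncomm_ring)) hx + hy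
  | smul r x _ hx =>
    have := congrArg (r • ·) hx
    simpa only [Ring.lie_def, smul_mul_assoc, mul_smul_comm, smul_sub, smul_add, sub_mul, mul_sub,
      smul_zero] using this
  | mem c hc =>
  rcases word a ha with rfl | ⟨p, ha⟩
  · simp [Ring.lie_def]
  rcases word b hb with rfl | ⟨q, hb⟩
  · simp [Ring.lie_def]
  rcases word c hc with rfl | ⟨r, hc⟩
  · simp [Ring.lie_def]
  exact (hS.engelAt _).engel ha hb hc rfl

end Propagation

section Engel

variable {R : Type*} [Ring R]

/-- A ring satisfying the linearized `2`-Engel identity in which `3 = 0` satisfies all its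
consequences collected in `EngelOn`. -/
lemma engelOn_univ (h3 : (3 : R) = 0)
    (h : ∀ a b c : R, ⁅⁅a, b⁆, c⁆ + ⁅⁅a, c⁆, b⁆ = 0) : EngelOn (Set.univ : Set R) := by
  have Q : ∀ a b c d : R, ⁅a, b⁆ * ⁅c, d⁆ + ⁅a, c⁆ * ⁅b, d⁆ = 0 := by
    intro a b c d
    linear_combination (norm := (simp only [Ring.lie_def]; noncomm_ring))
      h (a * d) b c - a * h d b c - h a b c * d + h3 * (⁅a, b⁆ * ⁅c, d⁆ + ⁅a, c⁆ * ⁅b, d⁆)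
  have P : ∀ a b c d e : R, ⁅a, b⁆ * ⁅⁅c, d⁆, e⁆ + ⁅a, c⁆ * ⁅⁅b, d⁆, e⁆ = 0 := by
    intro a b c d e
    linear_combination (norm := (simp only [Ring.lie_def]; noncomm_ring))
      -⁅a, b⁆ * h d c e - ⁅a, c⁆ * h d b e + Q a b ⁅d, e⁆ c + Q a c ⁅d, e⁆ b
  have W : ∀ a b c d e f : R, ⁅⁅a, b⁆, c⁆ * ⁅⁅d, e⁆, f⁆ = 0 := by
    have swap : ∀ a b c d e f : R,
        ⁅⁅a, b⁆, c⁆ * ⁅⁅d, e⁆, f⁆ + ⁅⁅d, b⁆, c⁆ * ⁅⁅a, e⁆, f⁆ = 0 := by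
      intro a b c d e f
      linear_combination (norm := (simp only [Ring.lie_def]; noncomm_ring))
        -h b a c * ⁅⁅d, e⁆, f⁆ - h b d c * ⁅⁅a, e⁆, f⁆ + P ⁅b, c⁆ a d e f
    intro a b c d e f
    have h1 : ⁅⁅a, b⁆, c⁆ * ⁅⁅d, e⁆, f⁆ = ⁅⁅d, e⁆, c⁆ * ⁅⁅a, b⁆, f⁆ := by
      linear_combination (norm := (simp only [Ring.lie_def]; noncomm_ring))
        swap a b c d e f - swap b d c e a f
    have h2 : ⁅⁅a, b⁆, c⁆ * ⁅⁅d, e⁆, f⁆ + ⁅⁅d, e⁆, c⁆ * ⁅⁅a, b⁆, f⁆ = 0 := by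
      linear_combination (norm := (simp only [Ring.lie_def]; noncomm_ring))
        -Q c ⁅a, b⁆ ⁅d, e⁆ f
    linear_combination (norm := noncomm_ring)
      h3 * (⁅⁅a, b⁆, c⁆ * ⁅⁅d, e⁆, f⁆) - h1 - h2
  have Z : ∀ a b c d : R, ⁅⁅⁅a, b⁆, c⁆, d⁆ = 0 := by
    intro a b c d
    linear_combination (norm := (simp only [Ring.lie_def]; noncomm_ring))
      h3 * ⁅⁅⁅a, b⁆, c⁆, d⁆ - (Q a b c d + Q c a b d + Q c b d a) - h ⁅a, b⁆ c d
  exact ⟨fun a _ b _ c _ d _ e _ f _ => W a b c d e f, fun a _ b _ c _ d _ e _ => P a b c d e,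
    fun a _ b _ c _ d _ => Z a b c d, fun a _ b _ c _ d _ => Q a b c d,
    fun a _ b _ c _ => h a b c⟩

end Engel

section AlternatingCommutator

variable {R ι : Type*} [Ring R]

/-- The product of commutators of consecutive letters of a list, with a left-normed triple
commutator at the end when the length is odd. -/
def altComm (y : ι → R) : List ι → R
  | [] => 1
  | [_] => 0
  | [a, b, c] => ⁅⁅y a, y b⁆, y c⁆
  | a :: b :: l => ⁅y a, y b⁆ * altComm y l

variable {y : ι → R}

lemma altComm_cons_cons (a b : ι) {l : List ι} (hl : l.length ≠ 1) :
    altComm y (a :: b :: l) = ⁅y a, y b⁆ * altComm y l := by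
  match l, hl with
  | [], _ => rfl
  | _ :: _ :: _, _ => rfl

lemma altComm_eq_zero {l : List ι} (hl : l.length = 1) : altComm y l = 0 := by
  obtain ⟨a, rfl⟩ := List.length_eq_one_iff.1 hl
  rfl

lemma map_altComm {R' : Type*} [Ring R'] (f : R →+* R') (y : ι → R) (l : List ι) :
    f (altComm y l) = altComm (f ∘ y) l := by
  fun_induction altComm y l with
  | case1 => simp [altComm]
  | case2 => simp [altComm]
  | case3 => simp [altComm, Ring.lie_def]
  | case4 a b l hl ih =>
    rw [altComm_cons_cons _ _ (by simpa [List.length_eq_one_iff] using hl), map_mul, ih]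
    simp [Ring.lie_def]

lemma altComm_swap (hR : EngelOn (Set.univ : Set R)) (l₁ l₂ : List ι) (a b : ι) :
    altComm y (l₁ ++ a :: b :: l₂) = -altComm y (l₁ ++ b :: a :: l₂) := by
  have E := fun a b c => hR.engel (y a) trivial (y b) trivial (y c) trivial
  have Q := fun a b c d =>
    hR.pair_mul_pair (y a) trivial (y b) trivial (y c) trivial (y d) trivial
  have P := fun a b c d e =>
    hR.pair_mul_triple (y a) trivial (y b) trivial (y c) trivial (y d) trivial (y e) trivial
  match l₁ with
  | [] =>
    match l₂ with
    | [c] => simp only [altComm, List.nil_append, Ring.lie_def]; noncomm_ring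
    | [] => simp only [altComm, List.nil_append, Ring.lie_def]; noncomm_ring
    | _ :: _ :: _ => simp only [altComm, List.nil_append, Ring.lie_def]; noncomm_ring
  | [x] =>
    match l₂ with
    | [] => exact eq_neg_of_add_eq_zero_left (E x a b)
    | [c] =>
      simp only [altComm, List.cons_append, List.nil_append, mul_one]
      exact eq_neg_of_add_eq_zero_left (Q x a b c)
    | [c, d] => exact eq_neg_of_add_eq_zero_left (P x a b c d)
    | c :: d :: e :: l =>
      simp only [List.cons_append, List.nil_append]
      rw [altComm_cons_cons x a (by simp), altComm_cons_cons b c (by simp),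
        altComm_cons_cons x b (by simp), altComm_cons_cons a c (by simp), ← mul_assoc, ← mul_assoc,
        ← neg_mul, eq_neg_of_add_eq_zero_left (Q x a b c)]
  | x :: x' :: l =>
    simp only [List.cons_append]
    rw [altComm_cons_cons x x' (by simp; omega), altComm_cons_cons x x' (by simp; omega),
      altComm_swap hR l l₂ a b, mul_neg]

lemma altComm_perm (hR : EngelOn (Set.univ : Set R)) {l l' : List ι} (h : l.Perm l') :
    altComm y l = altComm y l' ∨ altComm y l = -altComm y l' := by
  suffices H : ∀ l₁, altComm y (l₁ ++ l) = altComm y (l₁ ++ l') ∨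
      altComm y (l₁ ++ l) = -altComm y (l₁ ++ l') from H []
  induction h with
  | nil => simp
  | cons x _ ih => intro l₁; simpa using ih (l₁ ++ [x])
  | swap a b l => exact fun l₁ => .inr (altComm_swap hR _ _ _ _)
  | trans _ _ ih ih' =>
    intro l₁
    rcases ih l₁ with h | h <;> rcases ih' l₁ with h' | h' <;> simp [h, h']

lemma triple_mul_altComm (hR : EngelOn (Set.univ : Set R)) (a b c : ι) (l : List ι) :
    ⁅⁅y a, y b⁆, y c⁆ * altComm y l = 0 ∨
      ∃ l' : List ι, l'.Perm (a :: b :: c :: l) ∧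
        ⁅⁅y a, y b⁆, y c⁆ * altComm y l = altComm y l' := by
  fun_induction altComm y l with
  | case1 => exact .inr ⟨[a, b, c], .refl _, by simp [altComm]⟩
  | case2 => simp
  | case3 d e f =>
    exact .inl (hR.triple_mul_triple _ trivial _ trivial _ trivial _ trivial _ trivial _ trivial)
  | case4 d e l hl ih =>
    have Z := fun d => hR.central (y a) trivial (y b) trivial (y c) trivial d trivial
    have comm : ⁅⁅y a, y b⁆, y c⁆ * (⁅y d, y e⁆ * altComm y l) =
        ⁅y d, y e⁆ * (⁅⁅y a, y b⁆, y c⁆ * altComm y l) := by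
      rw [← mul_assoc, ← mul_assoc, sub_eq_zero.1 (Z ⁅y d, y e⁆)]
    rcases ih with h | ⟨l', hl', h⟩
    · exact .inl (by rw [comm, h, mul_zero])
    · refine .inr ⟨d :: e :: l', ?_, ?_⟩
      · classical grind
      · rw [comm, h, altComm_cons_cons _ _ (by rw [hl'.length_eq]; simp)]

variable {k : Type*} [CommRing k] [Algebra k R]

/-- The span of the products of the letters of the rearrangements of a list. -/
def wordSpan (k : Type*) [CommRing k] [Algebra k R] (y : ι → R) (L : List ι) : Submodule k R :=
  Submodule.span k {x | ∃ l : List ι, l.Perm L ∧ x = (l.map y).prod}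

/-- The span of the products of a sorted list of letters, taken from `M`, with an alternating
commutator on the remaining letters of `L`. -/
def sortedSpan (k : Type*) [CommRing k] [Algebra k R] [LinearOrder ι] (y : ι → R)
    (M L : List ι) : Submodule k R :=
  Submodule.span k {x | ∃ T l : List ι, T.Pairwise (· ≤ ·) ∧ T ⊆ M ∧ (T ++ l).Perm L ∧
    x = (T.map y).prod * altComm y l}

lemma mul_mem_wordSpan {L L' : List ι} {x z : R} (hx : x ∈ wordSpan k y L)
    (hz : z ∈ wordSpan k y L') : x * z ∈ wordSpan k y (L ++ L') := by
  have := Submodule.mul_mem_mul hx hz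
  rw [wordSpan, wordSpan, Submodule.span_mul_span] at this
  refine Submodule.span_mono ?_ this
  rintro _ ⟨_, ⟨l, hl, rfl⟩, _, ⟨l', hl', rfl⟩, rfl⟩
  exact ⟨l ++ l', hl.append hl', by simp⟩

lemma wordSpan_perm {L L' : List ι} (h : L.Perm L') : wordSpan k y L = wordSpan k y L' := by
  simp only [wordSpan, h.congr_right]

lemma lie_mem_wordSpan {L L' : List ι} {x z : R} (hx : x ∈ wordSpan k y L)
    (hz : z ∈ wordSpan k y L') : ⁅x, z⁆ ∈ wordSpan k y (L ++ L') :=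
  Submodule.sub_mem _ (mul_mem_wordSpan hx hz)
    (wordSpan_perm (k := k) (y := y) List.perm_append_comm ▸ mul_mem_wordSpan hz hx)

lemma prod_mem_wordSpan (l : List ι) : (l.map y).prod ∈ wordSpan k y l :=
  Submodule.subset_span ⟨l, .refl _, rfl⟩

lemma altComm_mem_wordSpan (l : List ι) : altComm y l ∈ wordSpan k y l := by
  have hy : ∀ a, y a ∈ wordSpan k y [a] := fun a => by
    simpa using prod_mem_wordSpan (k := k) (y := y) [a]
  fun_induction altComm y l with
  | case1 => simpa using prod_mem_wordSpan (k := k) (y := y) []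
  | case2 => exact zero_mem _
  | case3 a b c => simpa using lie_mem_wordSpan (lie_mem_wordSpan (hy a) (hy b)) (hy c)
  | case4 a b l _ ih => simpa using mul_mem_wordSpan (lie_mem_wordSpan (hy a) (hy b)) ih

variable [LinearOrder ι]

lemma sortedSpan_mono {M M' L L' : List ι} (hM : M ⊆ M') (hL : L.Perm L') :
    sortedSpan k y M L ≤ sortedSpan k y M' L' := by
  refine Submodule.span_mono ?_
  rintro x ⟨T, l, hT, hTM, hl, rfl⟩
  exact ⟨T, l, hT, List.Subset.trans hTM hM, hl.trans hL, rfl⟩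

lemma mul_mem_sortedSpan {M L : List ι} {i : ι} (hi : ∀ j ∈ M, i ≤ j) {x : R}
    (hx : x ∈ sortedSpan k y M L) : y i * x ∈ sortedSpan k y (i :: M) (i :: L) := by
  induction hx using Submodule.span_induction with
  | zero => simp
  | add x z _ _ hx hz => rw [mul_add]; exact add_mem hx hz
  | smul r x _ hx => rw [mul_smul_comm]; exact Submodule.smul_mem _ _ hx
  | mem x hx =>
    obtain ⟨T, l, hT, hTM, hl, rfl⟩ := hx
    refine Submodule.subset_span ⟨i :: T, l, ?_, ?_, ?_, ?_⟩
    · exact List.pairwise_cons.2 ⟨fun j hj => hi j (hTM hj), hT⟩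
    · exact List.cons_subset_cons _ hTM
    · exact hl.cons i
    · simp [mul_assoc]

lemma pair_mul_mem_sortedSpan (hR : EngelOn (Set.univ : Set R)) (a b : ι) {T : List ι}
    (hT : T.Pairwise (· ≤ ·)) (l : List ι) :
    ⁅y a, y b⁆ * ((T.map y).prod * altComm y l) ∈ sortedSpan k y T (a :: b :: (T ++ l)) := by
  induction T with
  | nil =>
    by_cases hl : l.length = 1
    · simp [altComm_eq_zero hl]
    · refine Submodule.subset_span ⟨[], a :: b :: l, by simp, by simp, by simp, ?_⟩
      simp [altComm_cons_cons _ _ hl]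
  | cons j T ih =>
    rw [List.pairwise_cons] at hT
    have h1 := mul_mem_sortedSpan hT.1 (ih hT.2)
    have h2 : (T.map y).prod * (⁅⁅y a, y b⁆, y j⁆ * altComm y l) ∈
        sortedSpan k y T (a :: b :: (j :: T ++ l)) := by
      rcases triple_mul_altComm hR a b j l (y := y) with h | ⟨l', hl', h⟩
      · simp [h]
      · rw [h]
        exact Submodule.subset_span ⟨T, l', hT.2, List.Subset.refl _, by grind, rfl⟩
    have h3 := add_mem (sortedSpan_mono (List.Subset.refl _)
      (by grind : (j :: a :: b :: (T ++ l)).Perm (a :: b :: (j :: T ++ l))) h1)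
      (sortedSpan_mono (List.subset_cons_self j T) (.refl _) h2)
    have Z : ⁅⁅y a, y b⁆, y j⁆ * (T.map y).prod = (T.map y).prod * ⁅⁅y a, y b⁆, y j⁆ :=
      sub_eq_zero.1 (hR.central (y a) trivial (y b) trivial (y j) trivial _ trivial)
    convert h3 using 1
    rw [List.map_cons, List.prod_cons]
    linear_combination (norm := (simp only [Ring.lie_def]; noncomm_ring)) Z * altComm y l

lemma letter_mul_mem_sortedSpan (hR : EngelOn (Set.univ : Set R)) (i : ι) {T : List ι}
    (hT : T.Pairwise (· ≤ ·)) (l : List ι) :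
    y i * ((T.map y).prod * altComm y l) ∈ sortedSpan k y (i :: T) (i :: (T ++ l)) := by
  induction T with
  | nil => exact Submodule.subset_span ⟨[i], l, by simp, by simp, by simp, by simp⟩
  | cons j T ih =>
    by_cases hij : i ≤ j
    · refine Submodule.subset_span ⟨i :: j :: T, l, ?_, by simp, by simp, by simp [mul_assoc]⟩
      exact List.pairwise_cons_cons.2 ⟨hij, List.pairwise_cons.2
        ⟨fun a ha => hij.trans ((List.pairwise_cons.1 hT).1 a ha), (List.pairwise_cons.1 hT).2⟩, hT⟩
    · rw [List.pairwise_cons] at hT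
      have h1 := mul_mem_sortedSpan (i := j) (by grind) (ih hT.2)
      have h2 := pair_mul_mem_sortedSpan (k := k) (y := y) hR i j hT.2 l
      have h3 := add_mem (sortedSpan_mono (by grind : j :: i :: T ⊆ i :: j :: T)
        (by grind : (j :: i :: (T ++ l)).Perm (i :: (j :: T ++ l))) h1)
        (sortedSpan_mono (by grind : T ⊆ i :: j :: T)
          (by grind : (i :: j :: (T ++ l)).Perm (i :: (j :: T ++ l))) h2)
      convert h3 using 1
      rw [List.map_cons, List.prod_cons]
      simp only [Ring.lie_def]
      noncomm_ring

lemma prod_mem_sortedSpan (hR : EngelOn (Set.univ : Set R)) (l : List ι) :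
    (l.map y).prod ∈ sortedSpan k y l l := by
  induction l with
  | nil => exact Submodule.subset_span ⟨[], [], by simp, by simp, by simp, by simp [altComm]⟩
  | cons i l ih =>
    rw [List.map_cons, List.prod_cons]
    generalize (l.map y).prod = x at ih
    induction ih using Submodule.span_induction with
    | zero => simp
    | add x z _ _ hx hz => rw [mul_add]; exact add_mem hx hz
    | smul r x _ hx => rw [mul_smul_comm]; exact Submodule.smul_mem _ _ hx
    | mem x hx =>
      obtain ⟨T, l', hT, hTM, hl, rfl⟩ := hx
      exact sortedSpan_mono (List.cons_subset_cons _ hTM) (hl.cons i)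
        (letter_mul_mem_sortedSpan hR i hT l')

lemma wordSpan_eq_sortedSpan (hR : EngelOn (Set.univ : Set R)) (L : List ι) :
    wordSpan k y L = sortedSpan k y L L := by
  refine le_antisymm (Submodule.span_le.2 ?_) (Submodule.span_le.2 ?_)
  · rintro _ ⟨l, hl, rfl⟩
    exact sortedSpan_mono hl.subset hl (prod_mem_sortedSpan hR l)
  · rintro _ ⟨T, l, -, -, hl, rfl⟩
    rw [← wordSpan_perm hl]
    exact mul_mem_wordSpan (prod_mem_wordSpan T) (altComm_mem_wordSpan l)

variable [Fintype ι]

/-- The sorted product of the letters outside `S` times the alternating commutator of those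
in `S`. -/
def altWord (y : ι → R) (S : Finset ι) : R :=
  (Sᶜ.sort.map y).prod * altComm y S.sort

lemma wordSpan_eq_span_range_altWord (hR : EngelOn (Set.univ : Set R)) {L : List ι}
    (hL : L.Nodup) (hL' : ∀ i, i ∈ L) :
    wordSpan k y L =
      Submodule.span k (Set.range fun S : {S : Finset ι // S.card ≠ 1} => altWord y S.1) := by
  rw [wordSpan_eq_sortedSpan hR]
  refine le_antisymm (Submodule.span_le.2 ?_) (Submodule.span_le.2 ?_)
  · rintro _ ⟨T, l, hT, -, hl, rfl⟩
    have hnd := hl.nodup_iff.2 hL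
    rw [List.nodup_append] at hnd
    have hlS : l.Perm l.toFinset.sort := by
      rw [List.perm_ext_iff_of_nodup hnd.2.1 (Finset.sort_nodup _ _)]
      simp
    have hTS : T = l.toFinsetᶜ.sort := by
      refine List.Perm.eq_of_pairwise' hT (Finset.pairwise_sort _ _) ?_
      rw [List.perm_ext_iff_of_nodup hnd.1 (Finset.sort_nodup _ _)]
      intro a
      have := hl.mem_iff.2 (hL' a)
      rw [List.mem_append] at this
      simp only [Finset.mem_sort, Finset.mem_compl, List.mem_toFinset]
      exact ⟨fun h h' => hnd.2.2 a h a h' rfl, fun h => this.resolve_right h⟩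
    by_cases hS : l.toFinset.card = 1
    · have : altComm y l = 0 := altComm_eq_zero (by rw [hlS.length_eq, Finset.length_sort, hS])
      simp [this]
    · have h : altWord y l.toFinset ∈ Submodule.span k
          (Set.range fun S : {S : Finset ι // S.card ≠ 1} => altWord y S.1) :=
        Submodule.subset_span ⟨⟨_, hS⟩, rfl⟩
      rw [altWord, ← hTS] at h
      rcases altComm_perm hR hlS (y := y) with h' | h'
      · rwa [h']
      · rw [h', mul_neg]
        exact neg_mem h
  · rintro _ ⟨S, rfl⟩
    refine Submodule.subset_span ⟨_, _, Finset.pairwise_sort _ _, fun i _ => hL' i, ?_, rfl⟩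
    rw [List.perm_ext_iff_of_nodup _ hL]
    · intro a
      simp [hL', em']
    · rw [List.nodup_append]
      refine ⟨Finset.sort_nodup _ _, Finset.sort_nodup _ _, ?_⟩
      simp only [Finset.mem_sort, Finset.mem_compl]
      rintro a ha b hb rfl
      exact ha hb

omit [LinearOrder ι] [Fintype ι] in
lemma altComm_eq_zero_of_mem {i : ι} (hi : y i = 1) {l : List ι} (hl : i ∈ l) :
    altComm y l = 0 := by
  fun_induction altComm y l with
  | case1 => simp at hl
  | case2 => rfl
  | case3 a b c =>
    simp only [List.mem_cons, List.not_mem_nil, or_false] at hl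
    rcases hl with rfl | rfl | rfl <;> simp [Ring.lie_def, hi]
  | case4 a b l _ ih =>
    simp only [List.mem_cons] at hl
    rcases hl with rfl | rfl | hl
    · simp [Ring.lie_def, hi]
    · simp [Ring.lie_def, hi]
    · rw [ih hl, mul_zero]

lemma linearIndependent_altWord {K : Type*} [Field K] [Algebra K R]
    (h : ∀ S : Finset ι, S.card ≠ 1 → ∃ (A : Type) (_ : Ring A) (_ : Algebra K A) (φ : R →ₐ[K] A),
      (∀ i ∉ S, φ (y i) = 1) ∧ altComm (φ ∘ y) S.sort ≠ 0) :
    LinearIndependent K fun S : {S : Finset ι // S.card ≠ 1} => altWord y S.1 := by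
  rw [Fintype.linearIndependent_iff]
  intro g hg
  suffices H : ∀ S : Finset ι, ∀ hS : S.card ≠ 1, g ⟨S, hS⟩ = 0 from fun S => H S.1 S.2
  intro S
  induction S using Finset.strongInduction with
  | H S ih =>
  intro hS
  obtain ⟨A, _, _, φ, hφ, hne⟩ := h S hS
  have hval : ∀ T, φ (altWord y T) = φ (Tᶜ.sort.map y).prod * altComm (φ ∘ y) T.sort := fun T => by
    rw [altWord, map_mul]
    congr 1
    exact map_altComm (φ : R →+* A) y _
  have h0 := congrArg φ hg
  rw [map_sum, map_zero, Finset.sum_eq_single ⟨S, hS⟩] at h0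
  · rw [map_smul, smul_eq_zero, hval] at h0
    refine h0.resolve_right ?_
    rw [map_list_prod, List.prod_eq_one, one_mul]
    · exact hne
    · intro x hx
      simp only [List.map_map, List.mem_map, Finset.mem_sort, Finset.mem_compl] at hx
      obtain ⟨i, hi, rfl⟩ := hx
      exact hφ i hi
  · rintro ⟨T, hT⟩ - hTS
    rw [map_smul, hval]
    by_cases hsub : T ⊆ S
    · rw [ih T (hsub.ssubset_of_ne fun e => hTS (Subtype.ext e)), zero_smul]
    · obtain ⟨i, hiT, hiS⟩ := Finset.not_subset.1 hsub
      rw [altComm_eq_zero_of_mem (i := i) (hφ i hiS) (by simpa using hiT), mul_zero, smul_zero]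
  · simp

end AlternatingCommutator

section TwistedWeyl

variable {ι C A : Type*} [CommRing C] [Ring A] [Algebra C A]

/-- Weyl algebra generators `t`, `d`, with scalars `u`, `w` satisfying the symmetries of the double
and triple commutators in a ring with the linearized `2`-Engel identity. -/
structure EngelDatum (t d : ι → A) (u : ι → ι → C) (w : ι → ι → ι → C) : Prop where
  three : (3 : C) = 0
  comm_t : ∀ i j, Commute (t i) (t j)
  comm_d : ∀ i j, Commute (d i) (d j)
  lie_self : ∀ i, ⁅d i, t i⁆ = 1
  lie_ne : ∀ i j, i ≠ j → ⁅d i, t j⁆ = 0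
  u_self : ∀ i, u i i = 0
  u_skew : ∀ i j, u i j = -u j i
  w_skew₁₂ : ∀ i j k, w i j k = -w j i k
  w_skew₂₃ : ∀ i j k, w i j k = -w i k j
  w_mul_w : ∀ i j k a b c, w i j k * w a b c = 0
  u_mul_u : ∀ i j k l, u i j * u k l = -(u i k * u j l)
  u_mul_w : ∀ i j k l m, u i j * w k l m = -(u i k * w j l m)
  w_mul_u : ∀ i j k l m, w i j k * u l m = -(w i l k * u j m)

lemma lie_sum_smul {κ : Type*} [Fintype κ] (f : κ → C) (g : κ → A) (b : A) :
    ⁅∑ i, f i • g i, b⁆ = ∑ i, f i • ⁅g i, b⁆ := by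
  simp only [Ring.lie_def, Finset.sum_mul, Finset.mul_sum, smul_mul_assoc, mul_smul_comm, smul_sub,
    Finset.sum_sub_distrib]

variable [Fintype ι] [LinearOrder ι]

/-- The differential operator added to the variable `t i`. -/
def engelShift (d : ι → A) (u : ι → ι → C) (w : ι → ι → ι → C) (i : ι) : A :=
  ∑ j, (if j < i then u i j else 0) • d j +
    ∑ j, ∑ k, (if j < i ∧ j < k then w i j k else 0) • (d j * d k)

/-- Elements satisfying the linearized `2`-Engel identity with prescribed commutators. -/
def engelLetter (t d : ι → A) (u : ι → ι → C) (w : ι → ι → ι → C) (i : ι) : A :=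
  t i + engelShift d u w i

namespace EngelDatum

variable {t d : ι → A} {u : ι → ι → C} {w : ι → ι → ι → C} (h : EngelDatum t d u w)
include h

lemma commute_shift_d (i a : ι) : Commute (engelShift d u w i) (d a) := by
  refine .add_left (.sum_left _ _ _ fun j _ => .smul_left (h.comm_d j a) _)
    (.sum_left _ _ _ fun j _ => .sum_left _ _ _ fun k _ => .smul_left ?_ _)
  exact (h.comm_d j a).mul_left (h.comm_d k a)

lemma commute_shift (i j : ι) : Commute (engelShift d u w i) (engelShift d u w j) := by
  refine .add_right (.sum_right _ _ _ fun k _ => .smul_right (h.commute_shift_d i k) _)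
    (.sum_right _ _ _ fun k _ => .sum_right _ _ _ fun l _ => .smul_right ?_ _)
  exact (h.commute_shift_d i k).mul_right (h.commute_shift_d i l)

omit [Fintype ι] [Algebra C A] in
lemma lie_eq_ite (i j : ι) : ⁅d i, t j⁆ = if i = j then 1 else 0 := by
  split_ifs with hij
  · exact hij ▸ h.lie_self i
  · exact h.lie_ne i j hij

lemma shift_lie (i j : ι) : ⁅engelShift d u w i, t j⁆ =
    algebraMap C A (if j < i then u i j else 0) +
      ∑ a, ((if j < i ∧ j < a then w i j a else 0) +
        (if a < i ∧ a < j then w i a j else 0)) • d a := by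
  have h1 : ∀ x y z : A, ⁅x + y, z⁆ = ⁅x, z⁆ + ⁅y, z⁆ := fun x y z => by
    simp only [Ring.lie_def]; noncomm_ring
  have h2 : ∀ x y z : A, ⁅x * y, z⁆ = x * ⁅y, z⁆ + ⁅x, z⁆ * y := fun x y z => by
    simp only [Ring.lie_def]; noncomm_ring
  have h3 : ∀ (f : ι → ι → C), ⁅∑ a, ∑ b, f a b • (d a * d b), t j⁆ =
      ∑ a, (f j a + f a j) • d a := fun f => by
    rw [← Fintype.sum_prod_type', lie_sum_smul, Fintype.sum_prod_type]
    simp only [h2, h.lie_eq_ite, smul_add, mul_ite, ite_mul, mul_one, mul_zero, one_mul, zero_mul,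
      smul_ite, smul_zero, add_smul, Finset.sum_add_distrib]
    simp [add_comm]
  rw [engelShift, h1, lie_sum_smul, h3]
  congr 1
  simp [h.lie_eq_ite, Algebra.algebraMap_eq_smul_one]

omit [Algebra C A] [Fintype ι] [LinearOrder ι] in
lemma w_self₂₃ (i j : ι) : w i j j = 0 := by
  linear_combination w i j j * h.three - h.w_skew₂₃ i j j

omit [Algebra C A] [Fintype ι] [LinearOrder ι] in
lemma w_self₁₂ (i j : ι) : w i i j = 0 := by
  linear_combination w i i j * h.three - h.w_skew₁₂ i i j

omit [Algebra C A] [Fintype ι] [LinearOrder ι] in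
lemma w_self₁₃ (i j : ι) : w i j i = 0 := by
  rw [h.w_skew₂₃, h.w_self₁₂, neg_zero]

lemma letter_lie_letter (i j : ι) : ⁅engelLetter t d u w i, engelLetter t d u w j⁆ =
    algebraMap C A (u i j) + ∑ a, w i j a • d a := by
  have e1 : ⁅engelLetter t d u w i, engelLetter t d u w j⁆ =
      ⁅engelShift d u w i, t j⁆ - ⁅engelShift d u w j, t i⁆ := by
    simp only [Ring.lie_def, engelLetter]
    linear_combination (norm := noncomm_ring) (h.commute_shift i j).eq + (h.comm_t i j).eq
  rw [e1, h.shift_lie, h.shift_lie, add_sub_add_comm, ← map_sub, ← Finset.sum_sub_distrib]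
  congr 1
  · congr 1
    have := h.u_self i
    have := h.u_skew i j
    grind
  · refine Finset.sum_congr rfl fun a _ => ?_
    rw [← sub_smul]
    congr 1
    have := h.three
    have := h.w_self₁₂ i
    have := h.w_self₂₃ i j
    have := h.w_self₁₃ i j
    have := h.w_self₁₂ j a
    have := h.w_skew₂₃ i j a
    have := h.w_skew₂₃ j i a
    have := h.w_skew₁₂ i j a
    grind

lemma triple (i j k : ι) :
    ⁅⁅engelLetter t d u w i, engelLetter t d u w j⁆, engelLetter t d u w k⁆ =
      algebraMap C A (w i j k) := by
  have hd : ∀ a, ⁅d a, engelLetter t d u w k⁆ = if a = k then 1 else 0 := fun a => by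
    rw [← h.lie_eq_ite]
    simp only [Ring.lie_def, engelLetter]
    linear_combination (norm := noncomm_ring) -(h.commute_shift_d k a).eq
  have hc : ∀ (c : C) (x y : A), ⁅algebraMap C A c + x, y⁆ = ⁅x, y⁆ := fun c x y => by
    simp only [Ring.lie_def]
    linear_combination (norm := noncomm_ring) Algebra.commutes c y
  rw [h.letter_lie_letter, hc, lie_sum_smul]
  simp [hd, Algebra.algebraMap_eq_smul_one]

omit [LinearOrder ι] in
lemma pair_mul_pair_eq (i j k l : ι) :
    (algebraMap C A (u i j) + ∑ a, w i j a • d a) * (algebraMap C A (u k l) + ∑ a, w k l a • d a) =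
      algebraMap C A (u i j * u k l) + ∑ a, (w i j a * u k l + u i j * w k l a) • d a := by
  have : (∑ a, w i j a • d a) * ∑ a, w k l a • d a = 0 := by
    simp [Finset.sum_mul_sum, smul_smul, h.w_mul_w]
  rw [mul_add, add_mul, add_mul, this]
  simp only [Algebra.algebraMap_eq_smul_one, add_smul, Finset.sum_add_distrib, smul_mul_assoc,
    mul_smul_comm, one_mul, mul_one, Finset.smul_sum, smul_smul, mul_comm (w _ _ _) (u _ _),
    mul_comm (u k l) (u i j)]
  abel

omit h [LinearOrder ι] in
lemma pair_mul_scalar (i j : ι) {c : C} (hc : ∀ a, w i j a * c = 0) :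
    (algebraMap C A (u i j) + ∑ a, w i j a • d a) * algebraMap C A c =
      algebraMap C A (u i j * c) := by
  have : ∀ a, c * w i j a = 0 := fun a => by rw [mul_comm, hc]
  rw [add_mul]
  simp only [Algebra.algebraMap_eq_smul_one, mul_smul_comm, mul_one, Finset.smul_sum,
    smul_smul, this, zero_smul, Finset.sum_const_zero, add_zero, mul_comm (u i j)]

lemma engelOn : EngelOn (Set.range (engelLetter t d u w)) where
  triple_mul_triple := by
    rintro _ ⟨i, rfl⟩ _ ⟨j, rfl⟩ _ ⟨k, rfl⟩ _ ⟨a, rfl⟩ _ ⟨b, rfl⟩ _ ⟨c, rfl⟩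
    rw [h.triple, h.triple, ← map_mul, h.w_mul_w, map_zero]
  pair_mul_triple := by
    rintro _ ⟨i, rfl⟩ _ ⟨j, rfl⟩ _ ⟨k, rfl⟩ _ ⟨a, rfl⟩ _ ⟨b, rfl⟩
    rw [h.triple, h.triple, h.letter_lie_letter, h.letter_lie_letter,
      pair_mul_scalar _ _ fun _ => h.w_mul_w _ _ _ _ _ _,
      pair_mul_scalar _ _ fun _ => h.w_mul_w _ _ _ _ _ _, h.u_mul_w, map_neg, neg_add_cancel]
  central := by
    rintro _ ⟨i, rfl⟩ _ ⟨j, rfl⟩ _ ⟨k, rfl⟩ _ ⟨a, rfl⟩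
    rw [h.triple, Ring.lie_def, Algebra.commutes, sub_self]
  pair_mul_pair := by
    rintro _ ⟨i, rfl⟩ _ ⟨j, rfl⟩ _ ⟨k, rfl⟩ _ ⟨l, rfl⟩
    simp only [h.letter_lie_letter, h.pair_mul_pair_eq]
    rw [add_add_add_comm, ← map_add, ← Finset.sum_add_distrib, h.u_mul_u, neg_add_cancel, map_zero,
      zero_add]
    refine Finset.sum_eq_zero fun a _ => ?_
    rw [← add_smul, show w i j a * u k l + u i j * w k l a +
      (w i k a * u j l + u i k * w j l a) = 0 by
        linear_combination h.w_mul_u i j a k l + h.u_mul_w i j k l a, zero_smul]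
  engel := by
    rintro _ ⟨i, rfl⟩ _ ⟨j, rfl⟩ _ ⟨k, rfl⟩
    rw [h.triple, h.triple, h.w_skew₂₃, map_neg, neg_add_cancel]

end EngelDatum

/-- The scalar to which the alternating commutator of a list of odd length at least three of the
elements `engelLetter t d u w` evaluates. -/
def engelScalar (u : ι → ι → C) (w : ι → ι → ι → C) : List ι → C
  | [a, b, c] => w a b c
  | a :: b :: l => u a b * engelScalar u w l
  | _ => 0

namespace EngelDatum

variable {t d : ι → A} {u : ι → ι → C} {w : ι → ι → ι → C} (h : EngelDatum t d u w)
include h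

omit [Algebra C A] [Fintype ι] [LinearOrder ι] in
lemma w_mul_engelScalar (i j k : ι) (l : List ι) : w i j k * engelScalar u w l = 0 := by
  fun_induction engelScalar u w l with
  | case1 => exact h.w_mul_w _ _ _ _ _ _
  | case2 a b l _ ih => rw [mul_left_comm, ih, mul_zero]
  | case3 => exact mul_zero _

lemma altComm_letter {l : List ι} (hl : Odd l.length) :
    altComm (engelLetter t d u w) l = algebraMap C A (engelScalar u w l) := by
  fun_induction engelScalar u w l with
  | case1 a b c => exact h.triple a b c
  | case2 a b l hl' ih =>
    by_cases h1 : l.length = 1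
    · obtain ⟨c, rfl⟩ := List.length_eq_one_iff.1 h1
      exact (hl' c rfl).elim
    · rw [altComm_cons_cons _ _ h1, ih (by simpa [parity_simps] using hl), h.letter_lie_letter,
        pair_mul_scalar _ _ fun a => h.w_mul_engelScalar _ _ _ _]
  | case3 l h1 h2 =>
    match l with
    | [] => simp at hl
    | [a] => simp [altComm]
    | a :: b :: l => exact (h2 a b l rfl).elim

end EngelDatum

end TwistedWeyl

section GrassmannModel

open ExteriorAlgebra in
/-- The standard generators of the exterior algebra of `ι → k`. -/
noncomputable def extGen (k : Type*) [CommRing k] {ι : Type*} [DecidableEq ι] (i : ι) :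
    ExteriorAlgebra k (ι → k) :=
  ExteriorAlgebra.ι k (Pi.single i 1)

variable {k ι : Type*} [CommRing k] [DecidableEq ι]

lemma extGen_mul_self (i : ι) : extGen k i * extGen k i = 0 :=
  ExteriorAlgebra.ι_sq_zero _

lemma extGen_anticomm (i j : ι) :
    extGen k i * extGen k j + extGen k j * extGen k i = 0 :=
  ExteriorAlgebra.ι_add_mul_swap _ _

lemma extGen_mul_mem_center (i j : ι) :
    extGen k i * extGen k j ∈ Subalgebra.center k (ExteriorAlgebra k (ι → k)) := by
  rw [Subalgebra.mem_center_iff]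
  intro b
  induction b using ExteriorAlgebra.induction with
  | algebraMap r => exact Algebra.commutes _ _
  | ι x =>
    have h1 := ExteriorAlgebra.ι_add_mul_swap (R := k) x (Pi.single i 1)
    have h2 := ExteriorAlgebra.ι_add_mul_swap (R := k) x (Pi.single j 1)
    simp only [extGen]
    linear_combination (norm := noncomm_ring)
      h1 * ExteriorAlgebra.ι k (Pi.single j 1) - ExteriorAlgebra.ι k (Pi.single i 1) * h2
  | mul a b ha hb => rw [mul_assoc, hb, ← mul_assoc, ha, mul_assoc]
  | add a b ha hb => rw [add_mul, mul_add, ha, hb]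

lemma prod_extGen_ne_zero [Nontrivial k] {l : List ι} (hl : l.Nodup) :
    (l.map (extGen k)).prod ≠ 0 := by
  classical
  intro h0
  let f : (ι → k) [⋀^Fin l.length]→ₗ[k] k :=
    Matrix.detRowAlternating.compLinearMap (LinearMap.funLeft k k l.get)
  have h1 := ExteriorAlgebra.liftAlternating_apply_ιMulti (Pi.single l.length f)
    fun p => Pi.single (l.get p) 1
  have h2 : ExteriorAlgebra.ιMulti k l.length (fun p => Pi.single (l.get p) 1) =
      (l.map (extGen k)).prod := by
    rw [ExteriorAlgebra.ιMulti_apply]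
    congr 1
    conv_rhs => rw [← List.ofFn_get l, List.map_ofFn]
    rfl
  rw [h2, h0, map_zero, Pi.single_eq_same] at h1
  have h3 : f (fun p => Pi.single (l.get p) 1) = 1 := by
    change Matrix.det _ = 1
    rw [← Matrix.det_one (n := Fin l.length) (R := k)]
    refine congrArg Matrix.det (Matrix.ext fun p q => ?_)
    simp [LinearMap.funLeft, Matrix.one_apply, Pi.single_apply, hl.getElem_inj_iff, Fin.ext_iff,
      eq_comm]
  exact one_ne_zero (h3.symm.trans h1.symm)

/-- The double commutators of the model. -/
noncomputable def extPair (k : Type*) [CommRing k] {ι : Type*} [DecidableEq ι] (i j : ι) :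
    Subalgebra.center k (ExteriorAlgebra k (ι → k)) :=
  ⟨extGen k i * extGen k j, extGen_mul_mem_center i j⟩

/-- The triple commutators of the model. -/
noncomputable def extTriple (k : Type*) [CommRing k] {ι : Type*} [DecidableEq ι] (o i j l : ι) :
    Subalgebra.center k (ExteriorAlgebra k (ι → k)) :=
  extPair k i j * extPair k l o

lemma coe_engelScalar (o : ι) {l : List ι} (hl : Odd l.length) (h1 : l.length ≠ 1) :
    ((engelScalar (extPair k) (extTriple k o) l :
      Subalgebra.center k (ExteriorAlgebra k (ι → k))) : ExteriorAlgebra k (ι → k)) =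
      ((l ++ [o]).map (extGen k)).prod := by
  fun_induction engelScalar (extPair k) (extTriple k o) l with
  | case1 a b c => simp [extTriple, extPair, mul_assoc]
  | case2 a b l hl' ih =>
    have h3 : l.length ≠ 1 := fun h => by
      obtain ⟨c, rfl⟩ := List.length_eq_one_iff.1 h
      exact hl' c rfl
    rw [Subalgebra.coe_mul, ih (by simpa [parity_simps] using hl) h3]
    simp [extPair, mul_assoc]
  | case3 l _ h2 =>
    match l with
    | [] => simp at hl
    | [a] => simp at h1
    | a :: b :: l => exact (h2 a b l rfl).elim

open MvPolynomial in
lemma engelDatum_ext (h3 : (3 : k) = 0) (o : ι) :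
    EngelDatum (A := Module.End (Subalgebra.center k (ExteriorAlgebra k (ι → k)))
        (MvPolynomial ι (Subalgebra.center k (ExteriorAlgebra k (ι → k)))))
      (fun i => LinearMap.mulLeft _ (X i)) (fun i => (pderiv i).toLinearMap)
      (extPair k) (extTriple k o) where
  three := by
    have := congrArg (algebraMap k (Subalgebra.center k (ExteriorAlgebra k (ι → k)))) h3
    rwa [map_ofNat, map_zero] at this
  comm_t i j := by
    refine LinearMap.ext fun p => ?_
    simp [mul_left_comm]
  comm_d i j := by
    set C := Subalgebra.center k (ExteriorAlgebra k (ι → k))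
    let D : ι → Derivation C (MvPolynomial ι C) (MvPolynomial ι C) := pderiv
    have : ⁅D i, D j⁆ = 0 := derivation_ext fun l => by
      rw [Derivation.commutator_apply]
      simp [D, pderiv_X, Pi.single_apply, apply_ite]
      exact sub_self _
    refine LinearMap.ext fun p => sub_eq_zero.1 ?_
    exact (Derivation.commutator_apply (D1 := D i) (D2 := D j) p).symm.trans
      (DFunLike.congr_fun this p)
  lie_self i := by
    refine LinearMap.ext fun p => ?_
    simp [Ring.lie_def]
  lie_ne i j hij := by
    refine LinearMap.ext fun p => ?_
    simp [Ring.lie_def, pderiv_X_of_ne hij.symm]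
  u_self i := Subtype.ext (extGen_mul_self i)
  u_skew i j := Subtype.ext (eq_neg_of_add_eq_zero_left (extGen_anticomm i j))
  w_skew₁₂ i j l := by
    refine eq_neg_of_add_eq_zero_left (Subtype.ext ?_)
    simp only [extTriple, extPair, Subalgebra.coe_add, Subalgebra.coe_mul, Subalgebra.coe_zero]
    linear_combination (norm := noncomm_ring)
      extGen_anticomm (k := k) i j * extGen k l * extGen k o
  w_skew₂₃ i j l := by
    refine eq_neg_of_add_eq_zero_left (Subtype.ext ?_)
    simp only [extTriple, extPair, Subalgebra.coe_add, Subalgebra.coe_mul, Subalgebra.coe_zero]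
    linear_combination (norm := noncomm_ring)
      extGen k i * extGen_anticomm (k := k) j l * extGen k o
  w_mul_w i j l a b c := by
    refine Subtype.ext ?_
    simp only [extTriple, extPair, Subalgebra.coe_mul, Subalgebra.coe_zero]
    linear_combination (norm := noncomm_ring)
      extGen k i * extGen k j * extGen k l * (
        extGen_anticomm (k := k) o a * extGen k b * extGen k c * extGen k o
          - extGen k a * extGen_anticomm (k := k) o b * extGen k c * extGen k o
          + extGen k a * extGen k b * extGen_anticomm (k := k) o c * extGen k o
          - extGen k a * extGen k b * extGen k c * extGen_mul_self (k := k) o)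
  u_mul_u i j l m := by
    refine eq_neg_of_add_eq_zero_left (Subtype.ext ?_)
    simp only [extPair, Subalgebra.coe_add, Subalgebra.coe_mul, Subalgebra.coe_zero]
    linear_combination (norm := noncomm_ring)
      extGen k i * extGen_anticomm (k := k) j l * extGen k m
  u_mul_w i j l m n := by
    refine eq_neg_of_add_eq_zero_left (Subtype.ext ?_)
    simp only [extTriple, extPair, Subalgebra.coe_add, Subalgebra.coe_mul, Subalgebra.coe_zero]
    linear_combination (norm := noncomm_ring)
      extGen k i * extGen_anticomm (k := k) j l * extGen k m * extGen k n * extGen k o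
  w_mul_u i j l m n := by
    refine eq_neg_of_add_eq_zero_left (Subtype.ext ?_)
    simp only [extTriple, extPair, Subalgebra.coe_add, Subalgebra.coe_mul, Subalgebra.coe_zero]
    linear_combination (norm := noncomm_ring)
      extGen k i * extGen k j * extGen k l * extGen_anticomm (k := k) o m * extGen k n
        - extGen k i * extGen k j * extGen_anticomm (k := k) l m * extGen k o * extGen k n
        + extGen k i * extGen_anticomm (k := k) j m * extGen k l * extGen k o * extGen k n
        - extGen k i * extGen k m * extGen_anticomm (k := k) j l * extGen k o * extGen k n
        + extGen k i * extGen k m * extGen k l * extGen_anticomm (k := k) j o * extGen k n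

end GrassmannModel

section EngelModel

lemma EngelOn.mono {R : Type*} [Ring R] {S T : Set R} (hT : EngelOn T) (h : S ⊆ T) :
    EngelOn S where
  triple_mul_triple a ha b hb c hc d hd e he f hf :=
    hT.triple_mul_triple a (h ha) b (h hb) c (h hc) d (h hd) e (h he) f (h hf)
  pair_mul_triple a ha b hb c hc d hd e he :=
    hT.pair_mul_triple a (h ha) b (h hb) c (h hc) d (h hd) e (h he)
  central a ha b hb c hc d hd := hT.central a (h ha) b (h hb) c (h hc) d (h hd)
  pair_mul_pair a ha b hb c hc d hd := hT.pair_mul_pair a (h ha) b (h hb) c (h hc) d (h hd)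
  engel a ha b hb c hc := hT.engel a (h ha) b (h hb) c (h hc)

lemma altComm_map {R ι κ : Type*} [Ring R] (y : κ → R) (f : ι → κ) (l : List ι) :
    altComm y (l.map f) = altComm (y ∘ f) l := by
  fun_induction altComm (y ∘ f) l with
  | case1 => rfl
  | case2 => rfl
  | case3 => rfl
  | case4 a b l hl ih =>
    have h1 : (l.map f).length ≠ 1 := fun h => by
      obtain ⟨c, rfl⟩ := List.length_eq_one_iff.1 (List.length_map f ▸ h)
      exact hl c rfl
    rw [List.map_cons, List.map_cons, altComm_cons_cons _ _ h1, ih]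
    rfl

lemma altComm_congr {R ι : Type*} [Ring R] {y z : ι → R} {l : List ι} (h : ∀ i ∈ l, y i = z i) :
    altComm y l = altComm z l := by
  rw [← l.attach_map_subtype_val, altComm_map, altComm_map]
  exact congrArg (altComm · l.attach) (funext fun i => h i i.2)

lemma altComm_append_triple {R ι : Type*} [Ring R] (y : ι → R) (a b c : ι) :
    ∀ l : List ι, Even l.length →
      altComm y (l ++ [a, b, c]) = altComm y l * ⁅⁅y a, y b⁆, y c⁆
  | [], _ => by simp [altComm]
  | [_], h => by simp at h
  | d :: e :: l, h => by
    have hl : Even l.length := by simpa [parity_simps] using h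
    rw [List.cons_append, List.cons_append, altComm_cons_cons _ _ (by simp),
      altComm_append_triple y a b c l hl,
      altComm_cons_cons _ _ fun h1 => Nat.not_even_one (h1 ▸ hl), mul_assoc]

variable {k : Type} [CommRing k] [Nontrivial k]

lemma altComm_engelLetter_ne_zero {ι : Type*} [Fintype ι] [LinearOrder ι] (h3 : (3 : k) = 0)
    (o : ι) {l : List ι} (hl : Odd l.length) (h1 : l.length ≠ 1) (hlo : (l ++ [o]).Nodup) :
    altComm (engelLetter (A := Module.End (Subalgebra.center k (ExteriorAlgebra k (ι → k)))
        (MvPolynomial ι (Subalgebra.center k (ExteriorAlgebra k (ι → k)))))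
      (fun i => LinearMap.mulLeft _ (MvPolynomial.X i))
      (fun i => (MvPolynomial.pderiv i).toLinearMap)
      (extPair k) (extTriple k o)) l ≠ 0 := by
  rw [(engelDatum_ext h3 o).altComm_letter hl]
  intro h0
  apply prod_extGen_ne_zero (k := k) hlo
  rw [← coe_engelScalar o hl h1]
  have := LinearMap.congr_fun h0 1
  rw [Module.algebraMap_end_apply, ← MvPolynomial.C_mul', mul_one, LinearMap.zero_apply,
    MvPolynomial.C_eq_zero] at this
  rw [this, Subalgebra.coe_zero]

variable (k) in
lemma exists_engelOn_range (h3 : (3 : k) = 0) (n : ℕ) :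
    ∃ (A : Type) (_ : Ring A) (_ : Algebra k A) (X : Fin n → A), EngelOn (Set.range X) ∧
      ∀ l : List (Fin n), l.Nodup → l.length ≠ 1 → altComm X l ≠ 0 := by
  let X := engelLetter
      (A := Module.End (Subalgebra.center k (ExteriorAlgebra k (Fin (n + 4) → k)))
        (MvPolynomial (Fin (n + 4)) (Subalgebra.center k (ExteriorAlgebra k (Fin (n + 4) → k)))))
      (fun i => LinearMap.mulLeft _ (MvPolynomial.X i))
      (fun i => (MvPolynomial.pderiv i).toLinearMap)
      (extPair k) (extTriple k (Fin.natAdd n 3))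
  have hX : EngelOn (Set.range X) := (engelDatum_ext h3 _).engelOn
  have hX' : ∀ l : List (Fin (n + 4)), Odd l.length → l.length ≠ 1 →
      (l ++ [Fin.natAdd n 3]).Nodup → altComm X l ≠ 0 := fun l =>
    altComm_engelLetter_ne_zero h3 _
  refine ⟨_, inferInstance, inferInstance, X ∘ Fin.castAdd 4, hX.mono ?_, fun l hl h1 => ?_⟩
  · exact Set.range_comp_subset_range _ _
  · have hmap : (l.map (Fin.castAdd 4)).Nodup := hl.map (Fin.castAdd_injective n 4)
    have hne : ∀ a ∈ l, ∀ j : Fin 4, Fin.castAdd 4 a ≠ Fin.natAdd n j := fun a _ j h => by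
      have := congrArg Fin.val h
      simp only [Fin.val_castAdd, Fin.val_natAdd] at this
      omega
    rw [← altComm_map]
    rcases Nat.even_or_odd l.length with he | ho
    · intro h0
      refine hX' (l.map (Fin.castAdd 4) ++ [Fin.natAdd n 0, Fin.natAdd n 1, Fin.natAdd n 2])
        ?_ ?_ ?_ ?_
      · simpa [parity_simps] using he
      · simp
      · rw [List.append_assoc, List.nodup_append]
        refine ⟨hmap, by simp [Fin.ext_iff], ?_⟩
        simp only [List.mem_map]
        rintro _ ⟨a, ha, rfl⟩ b hb
        simp only [List.cons_append, List.nil_append, List.mem_cons, List.not_mem_nil,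
          or_false] at hb
        rcases hb with rfl | rfl | rfl | rfl <;> exact hne a ha _
      · rw [altComm_append_triple _ _ _ _ _ (by simpa using he), h0, zero_mul]
    · refine hX' _ (by simpa using ho) (by simpa using h1) ?_
      rw [List.nodup_append]
      refine ⟨hmap, by simp, ?_⟩
      simp only [List.mem_map, List.mem_singleton]
      rintro _ ⟨a, ha, rfl⟩ b rfl
      exact hne a ha _

variable (k) in
/-- Over a ring of characteristic three there is an algebra with the linearized `2`-Engel identity
in which no alternating commutator of distinct generators vanishes. -/
lemma exists_engel_algebra (h3 : (3 : k) = 0) (n : ℕ) :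
    ∃ (A : Type) (_ : Ring A) (_ : Algebra k A) (X : Fin n → A),
      (∀ a b c : A, ⁅⁅a, b⁆, c⁆ + ⁅⁅a, c⁆, b⁆ = 0) ∧
      ∀ l : List (Fin n), l.Nodup → l.length ≠ 1 → altComm X l ≠ 0 := by
  obtain ⟨A, _, _, X, hX, hne⟩ := exists_engelOn_range k h3 n
  refine ⟨Algebra.adjoin k (Set.range X), inferInstance, inferInstance,
    fun i => ⟨X i, Algebra.subset_adjoin ⟨i, rfl⟩⟩, fun a b c => ?_, fun l hl h1 h0 => ?_⟩
  · exact Subtype.ext (hX.engel_adjoin a.2 b.2 c.2)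
  · refine hne l hl h1 ?_
    have := map_altComm (Algebra.adjoin k (Set.range X)).val.toRingHom
      (fun i => ⟨X i, Algebra.subset_adjoin ⟨i, rfl⟩⟩) l
    rw [h0, map_zero] at this
    exact this.symm

end EngelModel

section SymmSum

/-- The symmetric sum of the products of three elements. -/
def symmSum {F : Type*} [Add F] [Mul F] (a b c : F) : F :=
  a * b * c + b * a * c + c * a * b + a * c * b + b * c * a + c * b * a

lemma symmSum_rotate {F : Type*} [NonUnitalRing F] (a b c : F) :
    symmSum b c a = symmSum a b c := by
  simp only [symmSum]
  abel

lemma map_symmSum {F G Φ : Type*} [NonUnitalNonAssocSemiring F] [NonUnitalNonAssocSemiring G]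
    [FunLike Φ F G] [NonUnitalRingHomClass Φ F G] (f : Φ) (a b c : F) :
    f (symmSum a b c) = symmSum (f a) (f b) (f c) := by
  simp [symmSum]

lemma symmSum_eq {R : Type*} [Ring R] (h3 : (3 : R) = 0) (a b c : R) :
    symmSum a b c = ⁅⁅a, b⁆, c⁆ + ⁅⁅a, c⁆, b⁆ := by
  simp only [symmSum, Ring.lie_def]
  linear_combination (norm := noncomm_ring) h3 * (b * a * c + c * a * b)

lemma symmSum_algebraMap_add {k R : Type*} [CommRing k] [Ring R] [Algebra k R]
    (h3 : (3 : R) = 0) (r : k) (a b c : R) :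
    symmSum (algebraMap k R r + a) b c = symmSum a b c := by
  have hb := Algebra.commutes r b
  have hc := Algebra.commutes r c
  simp only [symmSum]
  linear_combination (norm := noncomm_ring)
    h3 * (algebraMap k R r * (b * c + c * b)) - 2 • (hb * c) - 2 • (hc * b) - b * hc - c * hb

end SymmSum

section IdealClosure

variable {k F : Type*} [CommRing k]

lemma idealClosure_le [AddCommGroup F] [Mul F] [Module k F] {S : Set F} {p : Submodule k F}
    (hS : S ⊆ p) (hp : ∀ a : F, ∀ x ∈ p, a * x ∈ p ∧ x * a ∈ p) : idealClosure k F S ≤ p :=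
  sInf_le ⟨hS, hp⟩

lemma subset_idealClosure [AddCommGroup F] [Mul F] [Module k F] (S : Set F) :
    S ⊆ idealClosure k F S := fun _ hx =>
  Submodule.mem_sInf.2 fun _ hp => hp.1 hx

lemma mul_mem_idealClosure [AddCommGroup F] [Mul F] [Module k F] {S : Set F} (a : F) {x : F}
    (hx : x ∈ idealClosure k F S) :
    a * x ∈ idealClosure k F S ∧ x * a ∈ idealClosure k F S := by
  simp only [idealClosure, Submodule.mem_sInf] at hx ⊢
  exact ⟨fun p hp => (hp.2 a x (hx p hp)).1, fun p hp => (hp.2 a x (hx p hp)).2⟩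

variable [NonUnitalRing F] [Module k F] [IsScalarTower k F F] [SMulCommClass k F F]

/-- A submodule of `F` closed under multiplication by elements of `F`, as an ideal of the
unitization of `F`. -/
def unitizationIdeal (I : Submodule k F) (hI : ∀ a : F, ∀ x ∈ I, a * x ∈ I ∧ x * a ∈ I) :
    Ideal (Unitization k F) where
  carrier := {r | r.fst = 0 ∧ r.snd ∈ I}
  zero_mem' := ⟨rfl, I.zero_mem⟩
  add_mem' := fun ha hb => ⟨by simp [ha.1, hb.1], I.add_mem ha.2 hb.2⟩
  smul_mem' a x hx := ⟨by simp [hx.1], by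
    simpa [hx.1] using I.add_mem (I.smul_mem _ hx.2) (hI _ _ hx.2).1⟩

variable {I : Submodule k F} {hI : ∀ a : F, ∀ x ∈ I, a * x ∈ I ∧ x * a ∈ I}

lemma mem_unitizationIdeal {r : Unitization k F} :
    r ∈ unitizationIdeal I hI ↔ r.fst = 0 ∧ r.snd ∈ I := Iff.rfl

instance : (unitizationIdeal I hI).IsTwoSided where
  mul_mem_of_left b h := ⟨by simp [h.1], by
    simpa [h.1] using I.add_mem (I.smul_mem _ h.2) (hI _ _ h.2).2⟩

end IdealClosure

section DualAlt

variable (n : ℕ)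

lemma dualAltIdealF3_mul_mem (a x : FreeAssocF3 n) (hx : x ∈ dualAltIdealF3 n) :
    a * x ∈ dualAltIdealF3 n ∧ x * a ∈ dualAltIdealF3 n :=
  mul_mem_idealClosure a hx

/-- The unital algebra obtained by adjoining a unit to the quotient of `FreeAssocF3 n` by the
dual alternative identity. -/
abbrev DualAltUnital : Type :=
  Unitization (ZMod 3) (FreeAssocF3 n) ⧸
    unitizationIdeal (dualAltIdealF3 n) (dualAltIdealF3_mul_mem n)

/-- The canonical map to the unital quotient. -/
noncomputable def toDualAltUnital : FreeAssocF3 n →ₙₐ[ZMod 3] DualAltUnital n :=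
  NonUnitalAlgHom.comp
    (Ideal.Quotient.mkₐ (ZMod 3) (unitizationIdeal (dualAltIdealF3 n)
      (dualAltIdealF3_mul_mem n)) : Unitization (ZMod 3) (FreeAssocF3 n) →ₙₐ[ZMod 3] _)
    (Unitization.inrNonUnitalAlgHom (ZMod 3) (FreeAssocF3 n))

/-- The images of the generators in the unital quotient. -/
noncomputable def dualAltGen (i : Fin n) : DualAltUnital n := toDualAltUnital n (xgen n i)

variable {n}

lemma toDualAltUnital_eq_zero {x : FreeAssocF3 n} :
    toDualAltUnital n x = 0 ↔ x ∈ dualAltIdealF3 n := by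
  refine Ideal.Quotient.eq_zero_iff_mem.trans (mem_unitizationIdeal.trans ?_)
  exact and_iff_right rfl

lemma three_eq_zero_of_algebra_zmod (R : Type*) [Ring R] [Algebra (ZMod 3) R] : (3 : R) = 0 := by
  have := congrArg (algebraMap (ZMod 3) R) (show (3 : ZMod 3) = 0 from rfl)
  rwa [map_ofNat, map_zero] at this

lemma engelOn_dualAltUnital : EngelOn (Set.univ : Set (DualAltUnital n)) := by
  have h3 := three_eq_zero_of_algebra_zmod (DualAltUnital n)
  refine engelOn_univ h3 fun a b c => ?_
  rw [← symmSum_eq h3]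
  have key : ∀ a : DualAltUnital n, ∃ (r : ZMod 3) (x : FreeAssocF3 n),
      a = algebraMap (ZMod 3) _ r + toDualAltUnital n x := fun a => by
    obtain ⟨a, rfl⟩ := Ideal.Quotient.mk_surjective a
    refine ⟨a.fst, a.snd, ?_⟩
    conv_lhs => rw [← Unitization.inl_fst_add_inr_snd_eq a]
    rfl
  obtain ⟨r, x, rfl⟩ := key a
  obtain ⟨s, y, rfl⟩ := key b
  obtain ⟨t, z, rfl⟩ := key c
  rw [symmSum_algebraMap_add h3, ← symmSum_rotate, symmSum_algebraMap_add h3, ← symmSum_rotate,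
    symmSum_algebraMap_add h3, ← map_symmSum, toDualAltUnital_eq_zero]
  exact subset_idealClosure _ ⟨_, _, _, rfl⟩

lemma exists_algHom_dualAltUnital {A : Type*} [Ring A] [Algebra (ZMod 3) A]
    (hA : ∀ a b c : A, ⁅⁅a, b⁆, c⁆ + ⁅⁅a, c⁆, b⁆ = 0) (X : Fin n → A) :
    ∃ φ : DualAltUnital n →ₐ[ZMod 3] A, ∀ i, φ (dualAltGen n i) = X i := by
  let f : FreeAssocF3 n →ₙₐ[ZMod 3] A := MonoidAlgebra.liftMagma (ZMod 3) (FreeSemigroup.lift X)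
  have hf : ∀ x ∈ dualAltIdealF3 n, f x = 0 := by
    have : dualAltIdealF3 n ≤ LinearMap.ker (f : FreeAssocF3 n →ₗ[ZMod 3] A) := by
      refine idealClosure_le ?_ fun a x hx => ?_
      · rintro _ ⟨a, b, c, rfl⟩
        exact (map_symmSum f a b c).trans
          ((symmSum_eq (three_eq_zero_of_algebra_zmod A) _ _ _).trans (hA _ _ _))
      · replace hx : f x = 0 := hx
        exact ⟨show f (a * x) = 0 by rw [map_mul, hx, mul_zero],
          show f (x * a) = 0 by rw [map_mul, hx, zero_mul]⟩
    exact this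
  refine ⟨Ideal.Quotient.liftₐ _ (Unitization.lift f) fun r hr => ?_, fun i => ?_⟩
  · obtain ⟨h1, h2⟩ := mem_unitizationIdeal.1 hr
    rw [← Unitization.inl_fst_add_inr_snd_eq r, h1]
    simp [hf _ h2]
  · have : f (xgen n i) = X i := by simp [f, xgen, MonoidAlgebra.liftMagma_apply_apply]
    refine Eq.trans ?_ this
    change Unitization.lift f (xgen n i) = _
    simp

variable (n) in
lemma linearIndependent_altWord_dualAltGen :
    LinearIndependent (ZMod 3)
      fun S : {S : Finset (Fin n) // S.card ≠ 1} => altWord (dualAltGen n) S.1 := by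
  classical
  obtain ⟨A, _, _, X, hA, hX⟩ := exists_engel_algebra (ZMod 3) rfl n
  refine linearIndependent_altWord fun S hS => ?_
  obtain ⟨φ, hφ⟩ := exists_algHom_dualAltUnital hA fun i => if i ∈ S then X i else 1
  refine ⟨A, inferInstance, inferInstance, φ, fun i hi => by rw [hφ, if_neg hi], fun h0 => ?_⟩
  refine hX S.sort (S.sort_nodup _) (by simpa using hS) (Eq.trans ?_ h0)
  exact altComm_congr fun i hi => by
    rw [Function.comp_apply, hφ, if_pos ((S.mem_sort _).1 hi)]

lemma finrank_wordSpan_dualAltGen {L : List (Fin n)} (hL : L.Nodup) (hL' : ∀ i, i ∈ L) :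
    Module.finrank (ZMod 3) (wordSpan (ZMod 3) (dualAltGen n) L) = 2 ^ n - n := by
  rw [wordSpan_eq_span_range_altWord engelOn_dualAltUnital hL hL',
    finrank_span_eq_card (linearIndependent_altWord_dualAltGen n), Fintype.card_subtype_compl,
    Fintype.card_finset_len, Fintype.card_finset, Fintype.card_fin, Nat.choose_one_right]

lemma List.perm_finRange_iff {l : List (Fin n)} :
    l.Perm (List.finRange n) ↔ ∃ σ : Equiv.Perm (Fin n), l = List.ofFn σ := by
  constructor
  · intro h
    have hlen : l.length = n := by simpa using h.length_eq
    obtain ⟨f, rfl⟩ : ∃ f : Fin n → Fin n, l = List.ofFn f :=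
      ⟨fun i => l.get (i.cast hlen.symm), List.ext_get (by simp [hlen]) (by simp)⟩
    have hinj : Function.Injective f :=
      List.nodup_ofFn.1 (h.nodup_iff.2 (List.nodup_finRange _))
    exact ⟨Equiv.ofBijective f (Finite.injective_iff_bijective.1 hinj), rfl⟩
  · rintro ⟨σ, rfl⟩
    simpa [List.ofFn_id] using σ.ofFn_comp_perm id

lemma toDualAltUnital_multilinearMonomial (m : ℕ) (σ : Equiv.Perm (Fin (m + 1))) :
    toDualAltUnital (m + 1) (multilinearMonomial m σ) =
      ((List.ofFn σ).map (dualAltGen (m + 1))).prod := by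
  have h : ∀ (l : List (FreeAssocF3 (m + 1))) x, toDualAltUnital (m + 1) (l.foldl (· * ·) x) =
      toDualAltUnital (m + 1) x * (l.map (toDualAltUnital (m + 1))).prod := fun l => by
    induction l with
    | nil => simp
    | cons a l ih => intro x; simp [ih, mul_assoc]
  rw [multilinearMonomial, h, List.ofFn_succ, List.map_cons, List.prod_cons, List.map_ofFn,
    List.map_ofFn]
  rfl

lemma finrank_span_mkQ_image {K V W : Type*} [Field K] [AddCommGroup V] [Module K V]
    [AddCommGroup W] [Module K W] {p : Submodule K V} {f : V →ₗ[K] W} (hf : LinearMap.ker f = p)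
    (s : Set V) :
    Module.finrank K (Submodule.span K (p.mkQ '' s)) =
      Module.finrank K (Submodule.span K (f '' s)) := by
  subst hf
  have hinj : Function.Injective ((LinearMap.ker f).liftQ f le_rfl) := by
    rw [← LinearMap.ker_eq_bot, Submodule.ker_liftQ_eq_bot _ _ _ le_rfl]
  rw [(Submodule.equivMapOfInjective _ hinj (Submodule.span K _)).finrank_eq, Submodule.map_span,
    Set.image_image]
  rfl

end DualAlt

/-- Over `𝔽₃`, the span of the images of the `n!` multilinear monomials in the
quotient of the free non-unital associative algebra on `n = m + 1` generators
by the dual alternative identity has dimension `2ⁿ − n`: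
`dim Alt^!(n) = 2ⁿ − n` in characteristic 3. -/
theorem dualAlt_dimension_char_three (m : ℕ) :
    Module.finrank (ZMod 3) (Submodule.span (ZMod 3)
      ((dualAltIdealF3 (m + 1)).mkQ ''
        {v | ∃ σ : Equiv.Perm (Fin (m + 1)), v = multilinearMonomial m σ}))
    = 2 ^ (m + 1) - (m + 1) := by
  let f : FreeAssocF3 (m + 1) →ₗ[ZMod 3] DualAltUnital (m + 1) :=
    { toFun := toDualAltUnital (m + 1)
      map_add' := (toDualAltUnital (m + 1)).map_add'
      map_smul' := (toDualAltUnital (m + 1)).map_smul' }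
  have hker : LinearMap.ker f = dualAltIdealF3 (m + 1) :=
    Submodule.ext fun _ => toDualAltUnital_eq_zero
  rw [finrank_span_mkQ_image hker, ← finrank_wordSpan_dualAltGen (List.nodup_finRange (m + 1))
    List.mem_finRange, wordSpan]
  suffices h : f '' {v | ∃ σ : Equiv.Perm (Fin (m + 1)), v = multilinearMonomial m σ} =
      {x | ∃ l : List (Fin (m + 1)), l.Perm (List.finRange (m + 1)) ∧
        x = (l.map (dualAltGen (m + 1))).prod} by
    rw [h]
  ext x
  constructor
  · rintro ⟨_, ⟨σ, rfl⟩, rfl⟩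
    exact ⟨_, List.perm_finRange_iff.2 ⟨σ, rfl⟩, toDualAltUnital_multilinearMonomial m σ⟩
  · rintro ⟨l, hl, rfl⟩
    obtain ⟨σ, rfl⟩ := List.perm_finRange_iff.1 hl
    exact ⟨_, ⟨σ, rfl⟩, toDualAltUnital_multilinearMonomial m σ⟩
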